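/- For Borel probability measures F* and F on [0, A] such that I(F*) and ∫₀^A i(x; F*) dF(x) are finite, the weak (Gateaux-type) derivative of I at F* in the direction of F satisfies lim_{θ → 0⁺} (I((1−θ)·F* + θ·F) − I(F*))/θ = ∫₀^A i(x; F*) dF(x) − I(F*). -/

import Mathlib

open MeasureTheory Real Set Filter

/-- Phase-removed Rayleigh-fading channel density `p(y|x)`. -/
noncomputable def pcond (x y : ℝ) : ℝ := (1 / (1 + x ^ 2)) * Real.exp (-y / (1 + x ^ 2))

/-- Modified Bessel function of the first kind, order zero. -/
noncomputable def besselI0 (t : ℝ) : ℝ := ∑' n : ℕ, (t ^ 2 / 4) ^ n / ((Nat.factorial n : ℝ)) ^ 2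

/-- Harvested-energy function `ℰ(x) = I₀(√2 B h₂ x)`. -/
noncomputable def EH (B h2 x : ℝ) : ℝ := besselI0 (Real.sqrt 2 * B * h2 * x)

/-- Output density `p(y; F)`. -/
noncomputable def pout (F : Measure ℝ) (y : ℝ) : ℝ := ∫ x, pcond x y ∂F

/-- Mutual-information density `i(x; F)`. -/
noncomputable def idens (F : Measure ℝ) (x : ℝ) : ℝ :=
  ∫ y in Set.Ioi (0 : ℝ), pcond x y * Real.log (pcond x y / pout F y)

/-- Mutual information `I(F)`. -/
noncomputable def MI (F : Measure ℝ) : ℝ := ∫ x, idens F x ∂F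

/-- Borel probability measure concentrated on `[0, A]`. -/
def IsDistOn (A : ℝ) (F : Measure ℝ) : Prop :=
  IsProbabilityMeasure F ∧ F (Set.Icc 0 A)ᶜ = 0

/-- The feasible set `Ω`: probability measures on `[0,A]` meeting the AP and EH constraints. -/
def Feas (A P B h2 Ereq : ℝ) (F : Measure ℝ) : Prop :=
  IsDistOn A F ∧ (∫ x, x ^ 2 ∂F) ≤ P ∧ Ereq ≤ ∫ x, EH B h2 x ∂F

/-- Information-energy capacity `C = sup_{F ∈ Ω} I(F)`. -/
noncomputable def Cap (A P B h2 Ereq : ℝ) : ℝ :=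
  sSup (MI '' {F | Feas A P B h2 Ereq F})

/-- Topological support of a measure: points all of whose open neighborhoods have
positive measure (the smallest closed set of full measure). -/
def msupp {X : Type*} [TopologicalSpace X] [MeasurableSpace X] (μ : Measure X) : Set X :=
  {x | ∀ U : Set X, IsOpen U → x ∈ U → 0 < μ U}

/-- Interval containing every output density at `y` induced by an input law on `[0, A]`. -/
def densityRange (A y : ℝ) : Set ℝ :=
  Set.Icc (Real.exp (-(Real.log (1 + A ^ 2) + y))) (Real.exp (-y / (1 + A ^ 2)))

/-- Integrable envelope of the entropy integrands. -/
noncomputable def envelope (A y : ℝ) : ℝ :=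
  (1 + Real.log (1 + A ^ 2) + y) * Real.exp (-y / (1 + A ^ 2))

/-- The negative conditional entropy of the output given the input `x`. -/
noncomputable def negCondEntropy (x : ℝ) : ℝ :=
  ∫ y in Set.Ioi (0 : ℝ), pcond x y * Real.log (pcond x y)

lemma log_one_add_sq_nonneg (A : ℝ) : 0 ≤ Real.log (1 + A ^ 2) :=
  Real.log_nonneg (by nlinarith [sq_nonneg A])

lemma pcond_mem_densityRange {A x y : ℝ} (hx : x ∈ Set.Icc 0 A) (hy : 0 < y) :
    pcond x y ∈ densityRange A y := by
  have h1 : (0 : ℝ) < 1 + x ^ 2 := by positivity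
  have h2 : 1 + x ^ 2 ≤ 1 + A ^ 2 := by nlinarith [hx.1, hx.2]
  have h3 : (0 : ℝ) < 1 + A ^ 2 := by positivity
  unfold pcond
  constructor
  · rw [neg_add, Real.exp_add, Real.exp_neg, Real.exp_log h3, ← one_div]
    gcongr
    rw [le_div_iff₀ h1]
    nlinarith [mul_nonneg hy.le (sq_nonneg x)]
  · calc 1 / (1 + x ^ 2) * Real.exp (-y / (1 + x ^ 2)) ≤ 1 * Real.exp (-y / (1 + A ^ 2)) := by
          gcongr ?_ * Real.exp ?_
          · rw [div_le_one h1]; nlinarith [sq_nonneg x]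
          · rw [neg_div, neg_div]; gcongr
      _ = _ := one_mul _

lemma densityRange_pos {A y t : ℝ} (ht : t ∈ densityRange A y) : 0 < t :=
  (Real.exp_pos _).trans_le ht.1

lemma abs_log_le_of_mem_densityRange {A y t : ℝ} (hy : 0 < y) (ht : t ∈ densityRange A y) :
    |Real.log t| ≤ Real.log (1 + A ^ 2) + y := by
  have h0 := densityRange_pos ht
  have h1 : t ≤ 1 := ht.2.trans (Real.exp_le_one_iff.2 (by
    rw [neg_div]; have : 0 ≤ y / (1 + A ^ 2) := by positivity
    linarith))
  rw [abs_of_nonpos (Real.log_nonpos h0.le h1)]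
  have := (Real.le_log_iff_exp_le h0).2 ht.1
  linarith

lemma abs_mul_log_le_envelope {A y s t : ℝ} (hy : 0 < y) (hs : s ∈ densityRange A y)
    (ht : t ∈ densityRange A y) : |s * Real.log t| ≤ envelope A y := by
  rw [abs_mul, abs_of_pos (densityRange_pos hs), mul_comm]
  have := log_one_add_sq_nonneg A
  exact mul_le_mul ((abs_log_le_of_mem_densityRange hy ht).trans (by linarith)) hs.2
    (densityRange_pos hs).le (by linarith)

lemma abs_le_envelope {A y t : ℝ} (hy : 0 < y) (ht : t ∈ densityRange A y) :
    |t| ≤ envelope A y := by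
  rw [abs_of_pos (densityRange_pos ht)]
  have := log_one_add_sq_nonneg A
  exact ht.2.trans (le_mul_of_one_le_left (Real.exp_pos _).le (by linarith))

lemma abs_mul_log_sub_mul_log_le {A y s t : ℝ} (hy : 0 < y) (hs : s ∈ densityRange A y)
    (ht : t ∈ densityRange A y) :
    |t * Real.log t - s * Real.log s| ≤ (1 + Real.log (1 + A ^ 2) + y) * |t - s| := by
  refine Convex.norm_image_sub_le_of_norm_hasDerivWithin_le (f := fun u : ℝ => u * Real.log u)
    (f' := fun u => Real.log u + 1) (s := densityRange A y)
    (fun u hu => (Real.hasDerivAt_mul_log (densityRange_pos hu).ne').hasDerivWithinAt)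
    (fun u hu => ?_) (convex_Icc _ _) hs ht
  have := abs_log_le_of_mem_densityRange hy hu
  rw [Real.norm_eq_abs]
  calc |Real.log u + 1| ≤ |Real.log u| + |1| := abs_add_le _ _
    _ ≤ _ := by rw [abs_one]; linarith

lemma integrableOn_envelope (A : ℝ) : IntegrableOn (envelope A) (Set.Ioi 0) := by
  have hb : (0 : ℝ) < 1 / (1 + A ^ 2) := by positivity
  have h1 := (exp_neg_integrableOn_Ioi 0 hb).const_mul (1 + Real.log (1 + A ^ 2))
  have h2 := integrableOn_rpow_mul_exp_neg_mul_rpow (p := 1) (s := 1) (by norm_num) one_pos hb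
  refine (h1.add h2).congr (ae_of_all _ fun y => ?_)
  simp only [Pi.add_apply, Real.rpow_one, envelope]
  rw [show -(1 / (1 + A ^ 2)) * y = -y / (1 + A ^ 2) by ring]
  ring

lemma continuous_pcond : Continuous (Function.uncurry pcond) := by
  have h : ∀ p : ℝ × ℝ, 1 + p.1 ^ 2 ≠ 0 := fun p => by positivity
  unfold Function.uncurry pcond
  fun_prop (disch := exact h)

lemma IsDistOn.ae_mem {A : ℝ} {F : Measure ℝ} (hF : IsDistOn A F) :
    ∀ᵐ x ∂F, x ∈ Set.Icc 0 A := hF.2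

lemma measurable_pout (F : Measure ℝ) [SFinite F] : Measurable (pout F) :=
  (continuous_pcond.stronglyMeasurable.integral_prod_left (μ := F)).measurable

lemma integrable_pcond_left {A y : ℝ} {F : Measure ℝ} (hF : IsDistOn A F) (hy : 0 < y) :
    Integrable (fun x => pcond x y) F := by
  have := hF.1
  refine Integrable.of_bound
    (continuous_pcond.comp (Continuous.prodMk_left y)).aestronglyMeasurable (envelope A y) ?_
  filter_upwards [hF.ae_mem] with x hx
  exact abs_le_envelope hy (pcond_mem_densityRange hx hy)

lemma pout_mem_densityRange {A y : ℝ} {F : Measure ℝ} (hF : IsDistOn A F) (hy : 0 < y) :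
    pout F y ∈ densityRange A y := by
  have := hF.1
  refine (convex_Icc _ _).integral_mem isClosed_Icc ?_ (integrable_pcond_left hF hy)
  filter_upwards [hF.ae_mem] with x hx using pcond_mem_densityRange hx hy

lemma integrableOn_of_abs_le_envelope {A : ℝ} {f : ℝ → ℝ} (hf : Measurable f)
    (h : ∀ y, 0 < y → |f y| ≤ envelope A y) : IntegrableOn f (Set.Ioi 0) :=
  (integrableOn_envelope A).mono' hf.aestronglyMeasurable
    ((ae_restrict_mem measurableSet_Ioi).mono fun y hy => h y hy)

lemma integrableOn_pout {A : ℝ} {F : Measure ℝ} (hF : IsDistOn A F) :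
    IntegrableOn (pout F) (Set.Ioi 0) := by
  have := hF.1
  exact integrableOn_of_abs_le_envelope (measurable_pout F) fun y hy =>
    abs_le_envelope hy (pout_mem_densityRange hF hy)

lemma integrableOn_pout_mul_log {A : ℝ} {F G : Measure ℝ} (hF : IsDistOn A F)
    (hG : IsDistOn A G) :
    IntegrableOn (fun y => pout F y * Real.log (pout G y)) (Set.Ioi 0) := by
  have := hF.1
  have := hG.1
  exact integrableOn_of_abs_le_envelope ((measurable_pout F).mul (measurable_pout G).log)
    fun y hy =>
      abs_mul_log_le_envelope hy (pout_mem_densityRange hF hy) (pout_mem_densityRange hG hy)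

lemma integrable_prod_of_abs_le_envelope {A : ℝ} {F : Measure ℝ} (hF : IsDistOn A F)
    {K : ℝ → ℝ → ℝ} (hK : Measurable (Function.uncurry K))
    (h : ∀ x ∈ Set.Icc 0 A, ∀ y, 0 < y → |K x y| ≤ envelope A y) :
    Integrable (Function.uncurry K) (F.prod (volume.restrict (Set.Ioi 0))) := by
  have := hF.1
  refine Integrable.mono' ((integrableOn_envelope A).comp_snd F) hK.aestronglyMeasurable ?_
  have h1 := Measure.quasiMeasurePreserving_fst (μ := F) (ν := volume.restrict (Set.Ioi (0 : ℝ)))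
    |>.ae hF.ae_mem
  have h2 := Measure.quasiMeasurePreserving_snd (μ := F) (ν := volume.restrict (Set.Ioi (0 : ℝ)))
    |>.ae (ae_restrict_mem measurableSet_Ioi)
  filter_upwards [h1, h2] with p hp1 hp2 using h _ hp1 _ hp2

lemma integral_pcond (x : ℝ) : ∫ y in Set.Ioi (0 : ℝ), pcond x y = 1 := by
  have h : (0 : ℝ) < 1 + x ^ 2 := by positivity
  have h' : -(1 / (1 + x ^ 2)) < 0 := by rw [neg_lt_zero]; positivity
  have := integral_exp_mul_Ioi h' 0
  simp only [pcond, integral_const_mul]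
  simp_rw [show ∀ y : ℝ, -y / (1 + x ^ 2) = -(1 / (1 + x ^ 2)) * y from fun y => by ring]
  rw [this, mul_zero, Real.exp_zero]
  field_simp

lemma integral_pout {A : ℝ} {F : Measure ℝ} (hF : IsDistOn A F) :
    ∫ y in Set.Ioi (0 : ℝ), pout F y = 1 := by
  have := hF.1
  have h := integral_integral_swap (integrable_prod_of_abs_le_envelope hF
    continuous_pcond.measurable fun x hx y hy => abs_le_envelope hy (pcond_mem_densityRange hx hy))
  simp only [integral_pcond] at h
  simpa [pout] using h.symm

lemma measurable_pcond_right (x : ℝ) : Measurable (pcond x) :=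
  continuous_pcond.measurable.comp measurable_prodMk_left

lemma integrable_negCondEntropy {A : ℝ} {F : Measure ℝ} (hF : IsDistOn A F) :
    Integrable negCondEntropy F := by
  have := hF.1
  exact (integrable_prod_of_abs_le_envelope (K := fun x y => pcond x y * Real.log (pcond x y)) hF
    (continuous_pcond.measurable.mul continuous_pcond.measurable.log) fun x hx y hy =>
    abs_mul_log_le_envelope hy (pcond_mem_densityRange hx hy)
      (pcond_mem_densityRange hx hy)).integral_prod_left

lemma idens_eq {A x : ℝ} {G : Measure ℝ} (hG : IsDistOn A G) (hx : x ∈ Set.Icc 0 A) :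
    idens G x = negCondEntropy x -
      ∫ y in Set.Ioi (0 : ℝ), pcond x y * Real.log (pout G y) := by
  have := hG.1
  have hp := measurable_pcond_right x
  unfold idens negCondEntropy
  rw [← integral_sub]
  · refine setIntegral_congr_fun measurableSet_Ioi fun y hy => ?_
    rw [Real.log_div (densityRange_pos (pcond_mem_densityRange hx hy)).ne'
      (densityRange_pos (pout_mem_densityRange hG hy)).ne', mul_sub]
  · exact integrableOn_of_abs_le_envelope (hp.mul hp.log) fun y hy =>
      abs_mul_log_le_envelope hy (pcond_mem_densityRange hx hy) (pcond_mem_densityRange hx hy)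
  · exact integrableOn_of_abs_le_envelope (hp.mul (measurable_pout G).log) fun y hy =>
      abs_mul_log_le_envelope hy (pcond_mem_densityRange hx hy) (pout_mem_densityRange hG hy)

lemma integral_idens {A : ℝ} {F G : Measure ℝ} (hF : IsDistOn A F) (hG : IsDistOn A G) :
    ∫ x, idens G x ∂F = (∫ x, negCondEntropy x ∂F) -
      ∫ y in Set.Ioi (0 : ℝ), pout F y * Real.log (pout G y) := by
  have := hF.1
  have := hG.1
  have hint := integrable_prod_of_abs_le_envelope
    (K := fun x y => pcond x y * Real.log (pout G y)) hF
    (continuous_pcond.measurable.mul ((measurable_pout G).comp measurable_snd).log)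
    fun x hx y hy =>
      abs_mul_log_le_envelope hy (pcond_mem_densityRange hx hy) (pout_mem_densityRange hG hy)
  rw [integral_congr_ae (hF.ae_mem.mono fun x hx => idens_eq hG hx),
    integral_sub (integrable_negCondEntropy hF) (by exact hint.integral_prod_left),
    integral_integral_swap hint]
  simp only [integral_mul_const, pout]

lemma IsDistOn.mix {A θ : ℝ} {F G : Measure ℝ} (hF : IsDistOn A F) (hG : IsDistOn A G)
    (h0 : 0 ≤ θ) (h1 : θ ≤ 1) :
    IsDistOn A (ENNReal.ofReal (1 - θ) • F + ENNReal.ofReal θ • G) := by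
  have := hF.1
  have := hG.1
  refine ⟨⟨?_⟩, ?_⟩
  · simp [← ENNReal.ofReal_add (sub_nonneg.2 h1) h0]
  · simp [hF.2, hG.2]

lemma integral_mix {θ : ℝ} {F G : Measure ℝ} {f : ℝ → ℝ} (hF : Integrable f F)
    (hG : Integrable f G) (h0 : 0 ≤ θ) (h1 : θ ≤ 1) :
    ∫ x, f x ∂(ENNReal.ofReal (1 - θ) • F + ENNReal.ofReal θ • G) =
      (1 - θ) * ∫ x, f x ∂F + θ * ∫ x, f x ∂G := by
  rw [integral_add_measure (hF.smul_measure ENNReal.ofReal_ne_top)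
    (hG.smul_measure ENNReal.ofReal_ne_top), integral_smul_measure, integral_smul_measure,
    ENNReal.toReal_ofReal (sub_nonneg.2 h1), ENNReal.toReal_ofReal h0, smul_eq_mul, smul_eq_mul]

lemma tendsto_mul_log_slope {p q : ℝ} (hp : 0 < p) :
    Tendsto (fun θ : ℝ => (((1 - θ) * p + θ * q) * Real.log ((1 - θ) * p + θ * q) -
      p * Real.log p) / θ) (nhdsWithin 0 (Set.Ioi 0)) (nhds ((Real.log p + 1) * (q - p))) := by
  have hlin : HasDerivAt (fun θ : ℝ => (1 - θ) * p + θ * q) (q - p) 0 := by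
    have h := (((hasDerivAt_id (0 : ℝ)).const_sub 1).mul_const p).add
      ((hasDerivAt_id (0 : ℝ)).mul_const q)
    exact h.congr_deriv (by ring)
  have h := HasDerivAt.comp (h₂ := fun u : ℝ => u * Real.log u) (h₂' := Real.log p + 1) 0
    (by simpa using Real.hasDerivAt_mul_log hp.ne') hlin
  have := h.tendsto_slope.mono_left (nhdsWithin_mono 0 fun θ (hθ : 0 < θ) => hθ.ne')
  refine this.congr fun θ => ?_
  simp [slope_def_field]

/-- The slope at `0⁺` of the negative output entropy along a mixture of input laws. -/
lemma tendsto_integral_mul_log_slope {A : ℝ} {F G : Measure ℝ} (hF : IsDistOn A F)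
    (hG : IsDistOn A G) :
    Tendsto (fun θ : ℝ => ∫ y in Set.Ioi (0 : ℝ),
      (((1 - θ) * pout F y + θ * pout G y) * Real.log ((1 - θ) * pout F y + θ * pout G y) -
        pout F y * Real.log (pout F y)) / θ) (nhdsWithin 0 (Set.Ioi 0))
      (nhds (∫ y in Set.Ioi (0 : ℝ), (Real.log (pout F y) + 1) * (pout G y - pout F y))) := by
  have := hF.1
  have := hG.1
  have mF := measurable_pout F
  have mG := measurable_pout G
  refine tendsto_integral_filter_of_dominated_convergence (fun y => 2 * envelope A y)
    (Eventually.of_forall fun θ => ?_) ?_ ((integrableOn_envelope A).const_mul 2) ?_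
  · have m : Measurable fun y => (1 - θ) * pout F y + θ * pout G y := by fun_prop
    exact (((m.mul m.log).sub (mF.mul mF.log)).div_const θ).aestronglyMeasurable
  · filter_upwards [Ioc_mem_nhdsGT (zero_lt_one' ℝ)] with θ hθ
    refine (ae_restrict_mem measurableSet_Ioi).mono fun y (hy : 0 < y) => ?_
    have hp := pout_mem_densityRange hF hy
    have hq := pout_mem_densityRange hG hy
    have hm : (1 - θ) * pout F y + θ * pout G y ∈ densityRange A y :=
      convex_Icc _ _ hp hq (sub_nonneg.2 hθ.2) hθ.1.le (by ring)
    have hb := abs_mul_log_sub_mul_log_le hy hp hm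
    have hpos : 0 ≤ 1 + Real.log (1 + A ^ 2) + y := by
      linarith [log_one_add_sq_nonneg A]
    have hd : |pout G y - pout F y| ≤ 2 * Real.exp (-y / (1 + A ^ 2)) := by
      rw [abs_le]
      constructor <;> linarith [hp.2, hq.2, densityRange_pos hp, densityRange_pos hq]
    rw [show (1 - θ) * pout F y + θ * pout G y - pout F y = θ * (pout G y - pout F y) by ring,
      abs_mul, abs_of_pos hθ.1] at hb
    rw [Real.norm_eq_abs, abs_div, abs_of_pos hθ.1, div_le_iff₀ hθ.1, envelope]
    refine hb.trans ?_
    calc (1 + Real.log (1 + A ^ 2) + y) * (θ * |pout G y - pout F y|)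
        ≤ (1 + Real.log (1 + A ^ 2) + y) * (θ * (2 * Real.exp (-y / (1 + A ^ 2)))) := by
          gcongr; exact hθ.1.le
      _ = _ := by ring
  · exact (ae_restrict_mem measurableSet_Ioi).mono fun y hy =>
      tendsto_mul_log_slope (densityRange_pos (pout_mem_densityRange hF hy))

/-- Weak (Gateaux-type) derivative of `I`: for Borel probability
measures `F*` and `F` on `[0, A]` such that `I(F*)` and `∫ i(x; F*) dF` are finite
(the relevant integrands are integrable),
`lim_{θ→0⁺} (I((1−θ)F* + θF) − I(F*))/θ = ∫ i(x; F*) dF − I(F*)`. -/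
theorem stmt12 (A : ℝ) (hA : 0 < A)
    (Fstar F : Measure ℝ) (hFstar : IsDistOn A Fstar) (hF : IsDistOn A F)
    (hint1 : Integrable (idens Fstar) Fstar) (hint2 : Integrable (idens Fstar) F) :
    Filter.Tendsto
      (fun θ : ℝ =>
        (MI (ENNReal.ofReal (1 - θ) • Fstar + ENNReal.ofReal θ • F) - MI Fstar) / θ)
      (nhdsWithin 0 (Set.Ioi 0))
      (nhds ((∫ x, idens Fstar x ∂F) - MI Fstar)) := by
  have iP := integrableOn_pout hFstar
  have iQ := integrableOn_pout hF
  have iPP := integrableOn_pout_mul_log hFstar hFstar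
  have iQP := integrableOn_pout_mul_log hF hFstar
  have hval : ∫ y in Set.Ioi (0 : ℝ),
      (Real.log (pout Fstar y) + 1) * (pout F y - pout Fstar y) =
      (∫ y in Set.Ioi (0 : ℝ), pout F y * Real.log (pout Fstar y)) -
        ∫ y in Set.Ioi (0 : ℝ), pout Fstar y * Real.log (pout Fstar y) := by
    have h : ∀ y, (Real.log (pout Fstar y) + 1) * (pout F y - pout Fstar y) =
        (pout F y * Real.log (pout Fstar y) - pout Fstar y * Real.log (pout Fstar y)) +
          (pout F y - pout Fstar y) := fun y => by ring
    simp_rw [h]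
    rw [integral_add (by exact iQP.sub iPP) (by exact iQ.sub iP), integral_sub iQP iPP, integral_sub iQ iP,
      integral_pout hF, integral_pout hFstar]
    ring
  have key := (tendsto_integral_mul_log_slope hFstar hF).const_sub
    ((∫ x, negCondEntropy x ∂F) - ∫ x, negCondEntropy x ∂Fstar)
  rw [hval] at key
  have hlim : (∫ x, idens Fstar x ∂F) - MI Fstar =
      ((∫ x, negCondEntropy x ∂F) - ∫ x, negCondEntropy x ∂Fstar) -
      ((∫ y in Set.Ioi (0 : ℝ), pout F y * Real.log (pout Fstar y)) -
        ∫ y in Set.Ioi (0 : ℝ), pout Fstar y * Real.log (pout Fstar y)) := by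
    rw [MI, integral_idens hF hFstar, integral_idens hFstar hFstar]
    ring
  rw [hlim]
  refine key.congr' ?_
  filter_upwards [Ioc_mem_nhdsGT (zero_lt_one' ℝ)] with θ hθ
  have hmix := hFstar.mix hF hθ.1.le hθ.2
  have hpout : ∀ y ∈ Set.Ioi (0 : ℝ),
      pout (ENNReal.ofReal (1 - θ) • Fstar + ENNReal.ofReal θ • F) y =
        (1 - θ) * pout Fstar y + θ * pout F y := fun y hy =>
    integral_mix (integrable_pcond_left hFstar hy) (integrable_pcond_left hF hy) hθ.1.le hθ.2
  have iMM := integrableOn_pout_mul_log hmix hmix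
  have hslope : ∫ y in Set.Ioi (0 : ℝ), (((1 - θ) * pout Fstar y + θ * pout F y) *
        Real.log ((1 - θ) * pout Fstar y + θ * pout F y) -
        pout Fstar y * Real.log (pout Fstar y)) / θ =
      ((∫ y in Set.Ioi (0 : ℝ), pout (ENNReal.ofReal (1 - θ) • Fstar + ENNReal.ofReal θ • F) y *
        Real.log (pout (ENNReal.ofReal (1 - θ) • Fstar + ENNReal.ofReal θ • F) y)) -
        ∫ y in Set.Ioi (0 : ℝ), pout Fstar y * Real.log (pout Fstar y)) / θ := by
    rw [← integral_sub iMM iPP, ← integral_div]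
    refine setIntegral_congr_fun measurableSet_Ioi fun y hy => ?_
    simp only [hpout y hy]
  rw [hslope, MI, MI, integral_idens hmix hmix, integral_idens hFstar hFstar,
    integral_mix (integrable_negCondEntropy hFstar) (integrable_negCondEntropy hF) hθ.1.le hθ.2]
  have := hθ.1.ne'
  field_simp
  ring
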